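/- For every δ > 0 and every constant C > 0 there exists Q₀ such that for every prime q ≥ Q₀ the following fails: λ(n) = -χ_q(n) for all integers 1 ≤ n ≤ q with gcd(n, q) = 1 except for at most C·q^{1-δ} exceptions. Equivalently, for every prime q ≥ Q₀, #{1 ≤ n ≤ q : gcd(n,q) = 1, λ(n) ≠ -χ_q(n)} > C·q^{1-δ}. -/

import Mathlib

open scoped BigOperators

/-- The Liouville function `λ(n) = (-1)^Ω(n)`. -/
def liouville (n : ℕ) : ℤ := (-1) ^ (ArithmeticFunction.cardFactors n)

open Filter Asymptotics

lemma liouville_mul {m n : ℕ} (hm : m ≠ 0) (hn : n ≠ 0) :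
    liouville (m * n) = liouville m * liouville n := by
  simp [liouville, ArithmeticFunction.cardFactors_mul hm hn, pow_add]

lemma liouville_eq_one_or (n : ℕ) : liouville n = 1 ∨ liouville n = -1 :=
  neg_one_pow_eq_or ℤ _

/-- The Liouville function twisted by the Jacobi symbol modulo `q`. -/
def twistedLiouville (q n : ℕ) : ℤ := liouville n * jacobiSym (n : ℤ) q

lemma twistedLiouville_mul (q : ℕ) {m n : ℕ} (hm : m ≠ 0) (hn : n ≠ 0) :
    twistedLiouville q (m * n) = twistedLiouville q m * twistedLiouville q n := by
  simp only [twistedLiouville, liouville_mul hm hn, Nat.cast_mul, jacobiSym.mul_left]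
  ring

lemma twistedLiouville_one (q : ℕ) : twistedLiouville q 1 = 1 := by
  simp [twistedLiouville, liouville]

lemma twistedLiouville_prod (q : ℕ) (s : Finset ℕ) (hs : ∀ p ∈ s, p ≠ 0) :
    twistedLiouville q (∏ p ∈ s, p) = ∏ p ∈ s, twistedLiouville q p := by
  induction s using Finset.cons_induction with
  | empty => simp [twistedLiouville_one]
  | cons a s ha ih =>
    have hs' : ∀ p ∈ s, p ≠ 0 := fun p hp => hs p (Finset.mem_cons_of_mem hp)
    rw [Finset.prod_cons, Finset.prod_cons, twistedLiouville_mul q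
      (hs a (Finset.mem_cons_self a s)) (Finset.prod_ne_zero_iff.2 hs'), ih hs']

lemma twistedLiouville_eq_one_or {q n : ℕ} (h : n.Coprime q) :
    twistedLiouville q n = 1 ∨ twistedLiouville q n = -1 := by
  have hJ := jacobiSym.eq_one_or_neg_one (a := (n : ℤ)) (b := q) (by simpa using h)
  rcases liouville_eq_one_or n with h1 | h1 <;> rcases hJ with h2 | h2 <;>
    simp [twistedLiouville, h1, h2]

lemma liouville_ne_neg_jacobiSym_iff {q n : ℕ} (h : n.Coprime q) :
    liouville n ≠ -jacobiSym (n : ℤ) q ↔ twistedLiouville q n = 1 := by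
  have hJ := jacobiSym.eq_one_or_neg_one (a := (n : ℤ)) (b := q) (by simpa using h)
  rcases liouville_eq_one_or n with h1 | h1 <;> rcases hJ with h2 | h2 <;>
    simp [twistedLiouville, h1, h2]

open Classical in
/-- The reduced `n ≤ q` at which `λ` differs from minus the Jacobi symbol modulo `q`. -/
noncomputable def exceptions (q : ℕ) : Finset ℕ :=
  (Finset.Icc 1 q).filter (fun n => n.Coprime q ∧ liouville n ≠ -jacobiSym (n : ℤ) q)

lemma mem_exceptions {q n : ℕ} :
    n ∈ exceptions q ↔ (1 ≤ n ∧ n ≤ q) ∧ n.Coprime q ∧ twistedLiouville q n = 1 := by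
  simp only [exceptions, Finset.mem_filter, Finset.mem_Icc]
  exact and_congr_right fun _ => and_congr_right fun h => liouville_ne_neg_jacobiSym_iff h

/-- If the twisted function is `-1` at `a`, then one of `n`, `a * n` is an exception. -/
lemma div_le_two_mul_card_exceptions {q a : ℕ} (hq : q.Prime) (ha : 2 ≤ a) (haq : a < q)
    (h : twistedLiouville q a = -1) : q / a ≤ 2 * (exceptions q).card := by
  have hcop : ∀ n, 1 ≤ n → n < q → n.Coprime q := fun n h1 h2 =>
    (Nat.coprime_of_lt_prime (by omega) h2 hq).symm
  have hsub : (Finset.Icc 1 (q / a)).image (a * ·) ⊆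
      exceptions q ∪ (exceptions q).image (a * ·) := by
    intro m hm
    obtain ⟨n, hn, rfl⟩ := Finset.mem_image.1 hm
    rw [Finset.mem_Icc] at hn
    have hnq : n < q := hn.2.trans_lt (Nat.div_lt_self hq.pos ha)
    have hanq : a * n ≤ q := (Nat.mul_le_mul_left a hn.2).trans (Nat.mul_div_le q a)
    have hc := hcop n hn.1 hnq
    rw [Finset.mem_union]
    rcases twistedLiouville_eq_one_or hc with h1 | h1
    · exact Or.inr (Finset.mem_image_of_mem _ (mem_exceptions.2 ⟨⟨hn.1, hnq.le⟩, hc, h1⟩))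
    · refine Or.inl (mem_exceptions.2
        ⟨⟨Nat.mul_pos (by omega) hn.1, hanq⟩, (hcop a (by omega) haq).mul_left hc, ?_⟩)
      rw [twistedLiouville_mul q (by omega) (by omega), h, h1]
      rfl
  have hinj : Function.Injective (a * ·) := mul_right_injective₀ (by omega)
  have := (Finset.card_le_card hsub).trans (Finset.card_union_le _ _)
  rw [Finset.card_image_of_injective _ hinj, Finset.card_image_of_injective _ hinj] at this
  simp at this
  omega

/-- If the twisted function is `1` at all primes up to `y`, then the products of `k` distinct
such primes are exceptions. -/
lemma choose_primeCounting_le_card_exceptions {q y k : ℕ} (hq : q.Prime) (hyq : y < q)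
    (hpow : y ^ k ≤ q) (h : ∀ p ≤ y, p.Prime → twistedLiouville q p = 1) :
    (Nat.primeCounting y).choose k ≤ (exceptions q).card := by
  rw [← Nat.primesLE_card_eq_primeCounting, ← Finset.card_powersetCard]
  refine Finset.card_le_card_of_injOn (fun s => ∏ p ∈ s, p) (fun s hs => ?_)
    (fun s hs t ht hst => ?_)
  · rw [Finset.mem_coe, Finset.mem_powersetCard] at hs
    have hp : ∀ p ∈ s, p ≤ y ∧ p.Prime := fun p hp => Nat.mem_primesLE.1 (hs.1 hp)
    have hp0 : ∀ p ∈ s, p ≠ 0 := fun p hps => (hp p hps).2.ne_zero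
    refine mem_exceptions.2 ⟨⟨Nat.pos_of_ne_zero (Finset.prod_ne_zero_iff.2 hp0), ?_⟩, ?_, ?_⟩
    · refine le_trans (Finset.prod_le_pow_card s _ y fun p hps => (hp p hps).1) ?_
      rwa [hs.2]
    · exact Nat.Coprime.prod_left fun p hps =>
        (Nat.coprime_of_lt_prime (hp0 p hps) ((hp p hps).1.trans_lt hyq) hq).symm
    · rw [twistedLiouville_prod q s hp0]
      exact Finset.prod_eq_one fun p hps => h p (hp p hps).1 (hp p hps).2
  · rw [Finset.mem_coe, Finset.mem_powersetCard] at hs ht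
    rw [← Nat.primeFactors_prod fun p hp => Nat.prime_of_mem_primesLE (hs.1 hp),
      ← Nat.primeFactors_prod fun p hp => Nat.prime_of_mem_primesLE (ht.1 hp)]
    exact congrArg Nat.primeFactors hst

lemma pow_le_or_choose_primeCounting_le {q y k : ℕ} (hq : q.Prime) (hk : 2 ≤ k) (hy : 2 ≤ y)
    (hpow : y ^ k ≤ q) :
    y ^ (k - 1) ≤ 2 * (exceptions q).card ∨
      (Nat.primeCounting y).choose k ≤ (exceptions q).card := by
  have hyq : y < q := (lt_self_pow₀ (by omega) (by omega)).trans_le hpow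
  by_cases h : ∀ p ≤ y, p.Prime → twistedLiouville q p = 1
  · exact Or.inr (choose_primeCounting_le_card_exceptions hq hyq hpow h)
  · push Not at h
    obtain ⟨p, hpy, hp, h⟩ := h
    have hcop := (Nat.coprime_of_lt_prime hp.ne_zero (hpy.trans_lt hyq) hq).symm
    refine Or.inl (le_trans ?_ (div_le_two_mul_card_exceptions hq hp.two_le (hpy.trans_lt hyq)
      ((twistedLiouville_eq_one_or hcop).resolve_left h)))
    rw [Nat.le_div_iff_mul_le hp.pos]
    calc y ^ (k - 1) * p ≤ y ^ (k - 1) * y := Nat.mul_le_mul_left _ hpy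
      _ = y ^ k := by rw [← pow_succ, Nat.sub_add_cancel (by omega)]
      _ ≤ q := hpow

lemma eventually_mul_rpow_le_primeCounting {d : ℝ} (hd : 0 < d) {M : ℝ} (hM : 0 < M) :
    ∀ᶠ y : ℕ in atTop, M * (y : ℝ) ^ (1 - d) ≤ Nat.primeCounting y := by
  have hlog2 : 0 < Real.log 2 := Real.log_pos one_lt_two
  have h1 := (isLittleO_log_rpow_atTop hd).bound (c := Real.log 2 / (2 * M)) (by positivity)
  have h2 := (isLittleO_log_rpow_atTop one_pos).bound (c := Real.log 2 / 4) (by positivity)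
  filter_upwards [tendsto_natCast_atTop_atTop.eventually h1,
    tendsto_natCast_atTop_atTop.eventually h2, eventually_ge_atTop 2] with y hy1 hy2 hy
  have hyR : (2 : ℝ) ≤ y := by exact_mod_cast hy
  have hy0 : (0 : ℝ) < y := by linarith
  have hlog : 0 < Real.log y := Real.log_pos (by linarith)
  rw [Real.norm_of_nonneg hlog.le, Real.norm_of_nonneg (by positivity)] at hy1 hy2
  rw [Real.rpow_one] at hy2
  have hlog' : Real.log (y + 1) ≤ 2 * Real.log y := by
    rw [← Real.log_rpow hy0]
    refine Real.log_le_log (by linarith) ?_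
    norm_num
    nlinarith
  refine le_trans ?_ (Chebyshev.pi_ge y)
  rw [le_div_iff₀ hlog]
  have h3 : M * (y : ℝ) ^ (1 - d) * Real.log y ≤ y * Real.log 2 / 2 := by
    calc M * (y : ℝ) ^ (1 - d) * Real.log y
        ≤ M * (y : ℝ) ^ (1 - d) * (Real.log 2 / (2 * M) * (y : ℝ) ^ d) := by gcongr
      _ = ((y : ℝ) ^ (1 - d) * (y : ℝ) ^ d) * Real.log 2 / 2 := by field_simp
      _ = y * Real.log 2 / 2 := by
        rw [← Real.rpow_add hy0, sub_add_cancel, Real.rpow_one]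
  linarith

lemma div_pow_le_choose {n k : ℕ} (h : 2 * k ≤ n) :
    ((n : ℝ) / (2 * k)) ^ k ≤ (n.choose k : ℝ) := by
  refine le_trans ?_ (Nat.pow_le_choose k n)
  have h1 : (n : ℝ) / 2 ≤ (n + 1 - k : ℕ) := by
    rw [div_le_iff₀ two_pos]
    exact_mod_cast (by omega : n ≤ (n + 1 - k) * 2)
  rw [← div_div, div_pow]
  gcongr
  exact_mod_cast Nat.factorial_le_pow k

lemma eventually_mul_rpow_lt_choose_primeCounting {d : ℝ} (hd : 0 < d) {C : ℝ}
    (hC : 0 < C) {k : ℕ} (hk : 1 ≤ k) :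
    ∀ᶠ y : ℕ in atTop,
      C * ((2 * y : ℝ) ^ k) ^ (1 - d) < ((Nat.primeCounting y).choose k : ℝ) := by
  have hk0 : (0 : ℝ) < k := by exact_mod_cast hk
  have htend := tendsto_atTop.1 Nat.tendsto_primeCounting (2 * k)
  filter_upwards [eventually_mul_rpow_le_primeCounting hd
    (M := 2 * k * (2 * (C + 1))) (by positivity), htend, eventually_ge_atTop 1] with y hy hky hy1
  have hy0 : (0 : ℝ) < y := by exact_mod_cast hy1
  have h2 : ((2 * y : ℝ) ^ k) ^ (1 - d) ≤ (2 * (y : ℝ) ^ (1 - d)) ^ k := by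
    rw [← Real.rpow_natCast, ← Real.rpow_mul (by positivity), mul_comm (k : ℝ),
      Real.rpow_mul (by positivity), Real.rpow_natCast, Real.mul_rpow (by norm_num) hy0.le]
    gcongr
    calc (2 : ℝ) ^ (1 - d) ≤ 2 ^ (1 : ℝ) :=
          Real.rpow_le_rpow_of_exponent_le one_le_two (by linarith)
      _ = 2 := Real.rpow_one 2
  have h3 : C < (C + 1) ^ k :=
    (lt_add_one C).trans_le (le_self_pow₀ (by linarith) (by omega))
  calc C * ((2 * y : ℝ) ^ k) ^ (1 - d)
      ≤ C * (2 * (y : ℝ) ^ (1 - d)) ^ k := by gcongr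
    _ < (C + 1) ^ k * (2 * (y : ℝ) ^ (1 - d)) ^ k := by gcongr
    _ = (2 * k * (2 * (C + 1)) * (y : ℝ) ^ (1 - d) / (2 * k)) ^ k := by
      rw [← mul_pow]
      congr 1
      field_simp
    _ ≤ ((Nat.primeCounting y : ℝ) / (2 * k)) ^ k := by gcongr
    _ ≤ _ := div_pow_le_choose hky

lemma eventually_mul_rpow_lt_pow {d C : ℝ} {k : ℕ} (hk : 1 < k * d) :
    ∀ᶠ y : ℕ in atTop, C * ((2 * y : ℝ) ^ k) ^ (1 - d) < (y : ℝ) ^ (k - 1) / 2 := by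
  have hk1 : 1 ≤ k := by
    rcases Nat.eq_zero_or_pos k with rfl | h
    · norm_num at hk
    · exact h
  have ht := (tendsto_rpow_atTop (sub_pos.2 hk)).comp (tendsto_natCast_atTop_atTop (R := ℝ))
  filter_upwards [ht.eventually_gt_atTop (2 * C * ((2 : ℝ) ^ k) ^ (1 - d)),
    eventually_ge_atTop 1] with y hy hy1
  have hy0 : (0 : ℝ) < y := by exact_mod_cast hy1
  have h1 : (y : ℝ) ^ (k - 1) = (y : ℝ) ^ (k * d - 1) * ((y : ℝ) ^ k) ^ (1 - d) := by
    rw [← Real.rpow_natCast, ← Real.rpow_natCast, ← Real.rpow_mul hy0.le, ← Real.rpow_add hy0]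
    congr 1
    push_cast [hk1]
    ring
  rw [h1, mul_pow, Real.mul_rpow (by positivity) (by positivity)]
  have h2 : 0 < ((y : ℝ) ^ k) ^ (1 - d) := by positivity
  have h3 := mul_lt_mul_of_pos_right hy h2
  simp only [Function.comp] at h3
  linarith

open Classical in
theorem liouville_does_not_pretend_to_be_minus_legendre
    (δ : ℝ) (hδ : 0 < δ) (C : ℝ) (hC : 0 < C) :
    ∃ Q₀ : ℕ, ∀ q : ℕ, q.Prime → Q₀ ≤ q →
      C * (q : ℝ) ^ ((1 : ℝ) - δ) <
        (((Finset.Icc 1 q).filter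
            (fun n => n.Coprime q ∧ liouville n ≠ -jacobiSym (n : ℤ) q)).card : ℝ) := by
  set d := min δ 1 with hd
  have hd0 : 0 < d := lt_min hδ one_pos
  have hd1 : d ≤ 1 := min_le_right _ _
  obtain ⟨k, hk⟩ := exists_nat_gt (1 / d)
  rw [div_lt_iff₀ hd0] at hk
  have hk2 : 2 ≤ k := by
    have : (1 : ℝ) < k := by nlinarith
    exact_mod_cast this
  obtain ⟨Y, hY⟩ := eventually_atTop.1
    ((eventually_mul_rpow_lt_choose_primeCounting hd0 hC (by omega : 1 ≤ k)).and
      (eventually_mul_rpow_lt_pow (C := C) hk))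
  refine ⟨(max Y 2) ^ k, fun q hq hQ => ?_⟩
  change _ < ((exceptions q).card : ℝ)
  set y := Nat.nthRoot k q
  have hk0 : k ≠ 0 := by omega
  have hle : y ^ k ≤ q := Nat.pow_nthRoot_le (Or.inl hk0)
  have hlt : q < (y + 1) ^ k := Nat.lt_pow_nthRoot_add_one hk0 q
  have hyY : max Y 2 ≤ y := (Nat.le_nthRoot_iff hk0).2 hQ
  have hy2 : 2 ≤ y := (le_max_right _ _).trans hyY
  obtain ⟨h1, h2⟩ := hY y ((le_max_left _ _).trans hyY)
  have hq1 : (1 : ℝ) ≤ q := by exact_mod_cast hq.one_le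
  have hqy : (q : ℝ) ≤ (2 * y : ℝ) ^ k := by
    exact_mod_cast hlt.le.trans (Nat.pow_le_pow_left (by omega) k)
  have hmain : C * (q : ℝ) ^ (1 - δ) ≤ C * ((2 * y : ℝ) ^ k) ^ (1 - d) := by
    gcongr
    calc (q : ℝ) ^ (1 - δ) ≤ (q : ℝ) ^ (1 - d) :=
          Real.rpow_le_rpow_of_exponent_le hq1 (by linarith [min_le_left δ 1])
      _ ≤ _ := Real.rpow_le_rpow (by linarith) hqy (by linarith)
  rcases pow_le_or_choose_primeCounting_le hq hk2 hy2 hle with h | h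
  · have h' : (y : ℝ) ^ (k - 1) ≤ 2 * ((exceptions q).card : ℝ) := by exact_mod_cast h
    linarith
  · have h' : ((Nat.primeCounting y).choose k : ℝ) ≤ (exceptions q).card := by exact_mod_cast h
    linarith
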